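/- There is a game in which committing to a strictly larger no-regret menu beats the no-swap-regret menu. Concretely, let m = 3 with learner actions labelled A, B, C, let n = 2 with optimizer actions labelled R, S, and fix any ε ∈ (0, 1/2). Define u_L by u_L(A,R)=0, u_L(A,S)=3, u_L(B,R)=7+ε, u_L(B,S)=2+ε, u_L(C,R)=7, u_L(C,S)=1, and u_O by u_O(A,R)=0, u_O(A,S)=1, u_O(B,R)=0, u_O(B,S)=1, u_O(C,R)=3, u_O(C,S)=0. Let φ ∈ Δ_{mn} be the CSP putting mass 1/2 on (C,R) and mass 1/2 on (A,S). Then: (i) φ ∈ M_NR; (ii) u_O(φ) = 2 and u_L(φ) = 5; (iii) every ψ ∈ M_NSR has u_O(ψ) ≤ 1; (iv) the point mass on (A,S) belongs to M_NSR; and (v) every ψ ∈ M_NSR with u_O(ψ) = 1 has u_L(ψ) ≤ 3. Consequently V_L(conv(M_NSR ∪ {φ}), u_O) = 5 > 3 = V_L(M_NSR, u_O). -/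

import Mathlib

open scoped BigOperators

noncomputable section

/-- Linear extension of a payoff function to CSPs. -/
def lin {m n : ℕ} (u : Fin m × Fin n → ℝ) (φ : Fin m × Fin n → ℝ) : ℝ :=
  ∑ p : Fin m × Fin n, φ p * u p

/-- The set `M_NR` of no-regret CSPs for learner payoff `uL`. -/
def MNR {m n : ℕ} (uL : Fin m × Fin n → ℝ) : Set (Fin m × Fin n → ℝ) :=
  {φ ∈ stdSimplex ℝ (Fin m × Fin n) |
    ∀ istar : Fin m, (∑ p : Fin m × Fin n, φ p * uL (istar, p.2)) ≤ lin uL φ}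

/-- The set `M_NSR` of no-swap-regret CSPs for learner payoff `uL`. -/
def MNSR {m n : ℕ} (uL : Fin m × Fin n → ℝ) : Set (Fin m × Fin n → ℝ) :=
  {φ ∈ stdSimplex ℝ (Fin m × Fin n) |
    ∀ i istar : Fin m,
      (∑ j : Fin n, φ (i, j) * uL (istar, j)) ≤ ∑ j : Fin n, φ (i, j) * uL (i, j)}

/-- `V_L(M, uO)`: the learner's value when the optimizer picks its
utility-maximizing CSP from `M`, breaking ties in the learner's favor. -/
def learnerVal {m n : ℕ} (uL uO : Fin m × Fin n → ℝ)
    (M : Set (Fin m × Fin n → ℝ)) : ℝ :=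
  sSup (lin uL '' {φ ∈ M | lin uO φ = sSup (lin uO '' M)})

theorem isLinearMap_lin {m n : ℕ} (u : Fin m × Fin n → ℝ) : IsLinearMap ℝ (lin u) where
  map_add φ ψ := by simp [lin, add_mul, Finset.sum_add_distrib]
  map_smul c φ := by simp [lin, mul_assoc, Finset.mul_sum]

/-- A CSP that maximizes the optimizer's payoff over `M`, and the learner's payoff among all such
maximizers, realizes the learner's value of `M`. -/
theorem learnerVal_eq {m n : ℕ} {uL uO : Fin m × Fin n → ℝ} {M : Set (Fin m × Fin n → ℝ)}
    {φ : Fin m × Fin n → ℝ} (hφ : φ ∈ M) (hO : ∀ ψ ∈ M, lin uO ψ ≤ lin uO φ)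
    (hL : ∀ ψ ∈ M, lin uO ψ = lin uO φ → lin uL ψ ≤ lin uL φ) :
    learnerVal uL uO M = lin uL φ := by
  have hmax : sSup (lin uO '' M) = lin uO φ :=
    IsGreatest.csSup_eq ⟨Set.mem_image_of_mem _ hφ, Set.forall_mem_image.2 hO⟩
  rw [learnerVal, hmax]
  exact IsGreatest.csSup_eq
    ⟨Set.mem_image_of_mem _ ⟨hφ, rfl⟩, Set.forall_mem_image.2 fun ψ hψ => hL ψ hψ.1 hψ.2⟩

/-- An upper bound for a payoff on a set of CSPs holds on its convex hull. -/
theorem lin_le_of_mem_convexHull {m n : ℕ} {u : Fin m × Fin n → ℝ} {c : ℝ}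
    {M : Set (Fin m × Fin n → ℝ)} (hM : ∀ ψ ∈ M, lin u ψ ≤ c) {ψ : Fin m × Fin n → ℝ}
    (hψ : ψ ∈ convexHull ℝ M) : lin u ψ ≤ c :=
  convexHull_min (t := {χ | lin u χ ≤ c}) hM (convex_halfSpace_le (isLinearMap_lin u) c) hψ

theorem lin_add_smul {m n : ℕ} (u v : Fin m × Fin n → ℝ) (c : ℝ) (φ : Fin m × Fin n → ℝ) :
    lin (u + c • v) φ = lin u φ + c * lin v φ := by
  simp [lin, mul_add, Finset.sum_add_distrib, Finset.mul_sum, mul_left_comm]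

/-- in the explicit 3×2 game of Theorem `nsr_not_optimal`,
committing to the strictly larger no-regret menu `conv(M_NSR ∪ {φ})` gives the
learner value 5, strictly beating the no-swap-regret menu's value 3. -/
theorem nsr_not_optimal (ε : ℝ) (hε0 : 0 < ε) (hε1 : ε < 1 / 2)
    (uL uO : Fin 3 × Fin 2 → ℝ)
    (huL : uL = fun p => !![(0 : ℝ), 3; 7 + ε, 2 + ε; 7, 1] p.1 p.2)
    (huO : uO = fun p => !![(0 : ℝ), 1; 0, 1; 3, 0] p.1 p.2)
    (φ : Fin 3 × Fin 2 → ℝ)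
    (hφ : φ = fun p => if p = (2, 0) then 1 / 2 else if p = (0, 1) then 1 / 2 else 0) :
    φ ∈ MNR uL ∧
    lin uO φ = 2 ∧ lin uL φ = 5 ∧
    (∀ ψ ∈ MNSR uL, lin uO ψ ≤ 1) ∧
    (fun p : Fin 3 × Fin 2 => if p = (0, 1) then (1 : ℝ) else 0) ∈ MNSR uL ∧
    (∀ ψ ∈ MNSR uL, lin uO ψ = 1 → lin uL ψ ≤ 3) ∧
    learnerVal uL uO (convexHull ℝ (MNSR uL ∪ {φ})) = 5 ∧
    learnerVal uL uO (MNSR uL) = 3 ∧ (3 : ℝ) < 5 := by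
  have hO (ψ : Fin 3 × Fin 2 → ℝ) : lin uO ψ = ψ (0, 1) + ψ (1, 1) + 3 * ψ (2, 0) := by
    simp [lin, huO, Fintype.sum_prod_type, Fin.sum_univ_three]
    ring
  have hL (ψ : Fin 3 × Fin 2 → ℝ) : lin uL ψ = 3 * ψ (0, 1) + (7 + ε) * ψ (1, 0) +
      (2 + ε) * ψ (1, 1) + 7 * ψ (2, 0) + ψ (2, 1) := by
    simp [lin, huL, Fintype.sum_prod_type, Fin.sum_univ_three]
    ring
  have hNSR (ψ) (hψ : ψ ∈ MNSR uL) :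
      (∀ p, 0 ≤ ψ p) ∧ ψ (0, 0) + ψ (0, 1) + ψ (1, 0) + ψ (1, 1) = 1 ∧
        ψ (2, 0) = 0 ∧ ψ (2, 1) = 0 := by
    obtain ⟨⟨hnn, hsum⟩, hreg⟩ := hψ
    have hCB := hreg 2 1
    simp [Fintype.sum_prod_type, Fin.sum_univ_three] at hsum
    simp [huL] at hCB
    have h20 := hnn (2, 0)
    have h21 := hnn (2, 1)
    have hp := mul_nonneg hε0.le h20
    have hq := mul_nonneg hε0.le h21
    have hC1 : ψ (2, 1) = 0 := by linarith
    have hC0 : ψ (2, 0) = 0 := by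
      have : ε * ψ (2, 0) = 0 := by linarith
      exact (mul_eq_zero.1 this).resolve_left hε0.ne'
    exact ⟨hnn, by linarith, hC0, hC1⟩
  have hφO : lin uO φ = 2 := by simp [hO, hφ]; norm_num
  have hφL : lin uL φ = 5 := by simp [hL, hφ]; norm_num
  have hNSRO : ∀ ψ ∈ MNSR uL, lin uO ψ ≤ 1 := fun ψ hψ => by
    obtain ⟨hnn, hsum, h20, -⟩ := hNSR ψ hψ
    rw [hO]
    linarith [hnn (0, 0), hnn (1, 0)]
  have hNSRL : ∀ ψ ∈ MNSR uL, lin uO ψ = 1 → lin uL ψ ≤ 3 := fun ψ hψ h => by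
    obtain ⟨hnn, hsum, h20, h21⟩ := hNSR ψ hψ
    rw [hO] at h
    have h10 : ψ (1, 0) = 0 := by linarith [hnn (0, 0), hnn (1, 0)]
    have h11 := mul_nonneg (show 0 ≤ 1 - ε by linarith) (hnn (1, 1))
    rw [hL, h10]
    linarith
  have hNSRL' : ∀ ψ ∈ MNSR uL, lin uL ψ ≤ 8 := fun ψ hψ => by
    obtain ⟨hnn, hsum, h20, h21⟩ := hNSR ψ hψ
    rw [hL]
    nlinarith [hnn (0, 0), hnn (0, 1), hnn (1, 0), hnn (1, 1)]
  have hAS : (fun p : Fin 3 × Fin 2 => if p = (0, 1) then (1 : ℝ) else 0) ∈ MNSR uL := by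
    refine ⟨⟨fun p => by dsimp only; split_ifs <;> norm_num, by simp⟩, fun i istar => ?_⟩
    fin_cases i <;> fin_cases istar <;> simp [huL]
    linarith
  have hφNR : φ ∈ MNR uL := by
    refine ⟨⟨fun p => ?_, ?_⟩, fun istar => ?_⟩
    · rw [hφ]
      dsimp only
      split_ifs <;> norm_num
    · simp [hφ, Fintype.sum_prod_type, Fin.sum_univ_three]
      norm_num
    · rw [hφL]
      fin_cases istar <;> simp [hφ, huL, Fintype.sum_prod_type, Fin.sum_univ_three] <;> linarith
  have hASO : lin uO (fun p : Fin 3 × Fin 2 => if p = (0, 1) then (1 : ℝ) else 0) = 1 := by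
    simp [hO]
  have hASL : lin uL (fun p : Fin 3 × Fin 2 => if p = (0, 1) then (1 : ℝ) else 0) = 3 := by
    simp [hL]
  refine ⟨hφNR, hφO, hφL, hNSRO, hAS, hNSRL, ?_, ?_, by norm_num⟩
  · rw [← hφL]
    refine learnerVal_eq (subset_convexHull ℝ _ (Or.inr rfl)) (fun ψ hψ => ?_) fun ψ hψ h => ?_
    · refine lin_le_of_mem_convexHull ?_ hψ
      rintro χ (hχ | rfl)
      · linarith [hNSRO χ hχ]
      · exact le_rfl
    · have hle : lin (uL + (3 : ℝ) • uO) ψ ≤ 11 := by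
        refine lin_le_of_mem_convexHull ?_ hψ
        rintro χ (hχ | rfl) <;> rw [lin_add_smul]
        · linarith [hNSRO χ hχ, hNSRL' χ hχ]
        · linarith
      rw [lin_add_smul] at hle
      linarith
  · rw [← hASL]
    refine learnerVal_eq hAS (fun ψ hψ => ?_) fun ψ hψ h => ?_
    · exact (hNSRO ψ hψ).trans_eq hASO.symm
    · exact (hNSRL ψ hψ (h.trans hASO)).trans_eq hASL.symm
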